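/- arXiv:2401.05304 — 3 statements merged into one kernel-verified Lean document; each statement's English description precedes it below -/
import Mathlib

section
/- Let K ≥ 1 be a natural number, let T ≥ 1 be a real number, and let C > 0. For each i ∈ {1,…,K} let Δ_i ≥ 0, let f_i ∈ (0,1], and let N_i ≥ 0 be real numbers such that N_i ≤ C·ln(T)/(Δ_i²·f_i) for every i with Δ_i > 0, and such that ∑_{i=1}^{K} N_i ≤ T. Then ∑_{i : Δ_i > 0} Δ_i · N_i ≤ √( C · T · ln(T) · ∑_{j=1}^{K} 1/f_j ). -/
/-- **Regret conversion lemma, second bound.**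
If `Δ i ≥ 0` are suboptimality gaps, `f i ∈ (0,1]` feedback probabilities, and the
pull counts `N i ≥ 0` satisfy `N i ≤ C ln T / (Δ i ^ 2 * f i)` whenever `Δ i > 0`
and `∑ i, N i ≤ T`, then
`∑_{i : Δ i > 0} Δ i * N i ≤ √(C * T * ln T * ∑ j, 1 / f j)`. -/
theorem sum_gap_mul_count_le_sqrt
    (K : ℕ) (hK : 1 ≤ K) (T : ℝ) (hT : 1 ≤ T) (C : ℝ) (hC : 0 < C)
    (Δ f N : Fin K → ℝ)
    (hΔ : ∀ i, 0 ≤ Δ i)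
    (hf : ∀ i, f i ∈ Set.Ioc (0 : ℝ) 1)
    (hN : ∀ i, 0 ≤ N i)
    (hbound : ∀ i, 0 < Δ i → N i ≤ C * Real.log T / (Δ i ^ 2 * f i))
    (htotal : ∑ i, N i ≤ T) :
    ∑ i ∈ Finset.univ.filter (fun i => 0 < Δ i), Δ i * N i ≤
      Real.sqrt (C * T * Real.log T * ∑ j, 1 / f j) := by
  have hL : 0 ≤ C * Real.log T := mul_nonneg hC.le (Real.log_nonneg hT)
  have hsecond : ∀ i, Δ i ^ 2 * N i ≤ C * Real.log T * (1 / f i) := by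
    intro i
    have hfi := (hf i).1
    rcases (hΔ i).eq_or_lt with h | h
    · rw [← h, zero_pow two_ne_zero, zero_mul]
      positivity
    · have hNi := hbound i h
      rw [le_div_iff₀ (by positivity)] at hNi
      rw [mul_one_div, le_div_iff₀ hfi]
      linarith
  apply Real.le_sqrt_of_sq_le
  calc (∑ i ∈ Finset.univ.filter (fun i => 0 < Δ i), Δ i * N i) ^ 2
      ≤ (∑ i, Δ i * N i) ^ 2 := by
        gcongr
        · exact Finset.sum_nonneg fun i _ => mul_nonneg (hΔ i) (hN i)
        · exact fun i _ _ => mul_nonneg (hΔ i) (hN i)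
        · exact Finset.filter_subset _ _
    _ ≤ (∑ i, N i) * ∑ i, Δ i ^ 2 * N i :=
        Finset.sum_sq_le_sum_mul_sum_of_sq_le_mul _ (fun i _ => hN i)
          (fun i _ => mul_nonneg (sq_nonneg _) (hN i)) (fun i _ => le_of_eq (by ring))
    _ ≤ T * ∑ i, C * Real.log T * (1 / f i) :=
        mul_le_mul htotal (Finset.sum_le_sum fun i _ => hsecond i)
          (Finset.sum_nonneg fun i _ => mul_nonneg (sq_nonneg _) (hN i)) (by linarith)
    _ = C * T * Real.log T * ∑ j, 1 / f j := by
        rw [← Finset.mul_sum]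
        ring
end

section
/- Let K ≥ 1 and T ≥ 1 be natural numbers, let η > 0, and let ℓ̂_{i,t} ≥ 0 be real numbers for i ∈ {1,…,K} and t ∈ {1,…,T}. Define weights w_{i,1} = 1 and w_{i,t+1} = w_{i,t}·exp(−η·ℓ̂_{i,t}) for all i and t, and probabilities π_{i,t} = w_{i,t} / ∑_{j=1}^{K} w_{j,t}. Then for every i* ∈ {1,…,K}: −∑_{t=1}^{T} ℓ̂_{i*,t} ≤ −∑_{t=1}^{T} ∑_{i=1}^{K} π_{i,t}·ℓ̂_{i,t} + η·∑_{t=1}^{T} ∑_{i=1}^{K} π_{i,t}·ℓ̂_{i,t}² + (ln K)/η. -/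
/-- The second-order upper bound for the decaying exponential on the nonnegative reals. -/
theorem Real.exp_neg_le_one_sub_add_sq {x : ℝ} (hx : 0 ≤ x) :
    Real.exp (-x) ≤ 1 - x + x ^ 2 := by
  rw [Real.exp_neg, inv_le_iff_one_le_mul₀ (Real.exp_pos x)]
  have hq : 0 ≤ 1 - x + x ^ 2 := by nlinarith [sq_nonneg (x - 1)]
  refine le_trans ?_ (mul_le_mul_of_nonneg_left (Real.quadratic_le_exp_of_nonneg hx) hq)
  nlinarith [pow_nonneg hx 2, pow_nonneg hx 3, pow_nonneg hx 4]

theorem Fin.sum_univ_telescope {M : Type*} [AddCommGroup M] (g : ℕ → M) (n : ℕ) :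
    ∑ t : Fin n, (g (t + 1) - g t) = g n - g 0 := by
  rw [Fin.sum_univ_eq_sum_range (fun t => g (t + 1) - g t), Finset.sum_range_sub]

/-- One multiplicative-weights update changes the log-potential by at most the negated mean loss
plus a second-moment term. -/
theorem log_sum_mul_exp_sub_log_sum_le {ι : Type*} [Fintype ι] [Nonempty ι]
    {η : ℝ} (hη : 0 ≤ η) {v l : ι → ℝ} (hv : ∀ i, 0 < v i) (hl : ∀ i, 0 ≤ l i) :
    Real.log (∑ i, v i * Real.exp (-η * l i)) - Real.log (∑ i, v i) ≤
      -η * ∑ i, v i / (∑ j, v j) * l i + η ^ 2 * ∑ i, v i / (∑ j, v j) * l i ^ 2 := by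
  have hV : 0 < ∑ i, v i := Finset.sum_pos (fun i _ => hv i) Finset.univ_nonempty
  have hV' : 0 < ∑ i, v i * Real.exp (-η * l i) :=
    Finset.sum_pos (fun i _ => mul_pos (hv i) (Real.exp_pos _)) Finset.univ_nonempty
  rw [← Real.log_div hV'.ne' hV.ne']
  refine (Real.log_le_sub_one_of_pos (div_pos hV' hV)).trans ?_
  have hone : ∑ i, v i / (∑ j, v j) = 1 := by
    rw [← Finset.sum_div, div_self hV.ne']
  rw [Finset.sum_div, sub_le_iff_le_add]
  calc ∑ i, v i * Real.exp (-η * l i) / ∑ j, v j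
      ≤ ∑ i, (-η * (v i / (∑ j, v j) * l i) + η ^ 2 * (v i / (∑ j, v j) * l i ^ 2)
          + v i / (∑ j, v j)) := by
        refine Finset.sum_le_sum fun i _ => ?_
        have h := mul_le_mul_of_nonneg_left
          (Real.exp_neg_le_one_sub_add_sq (mul_nonneg hη (hl i))) (div_pos (hv i) hV).le
        rw [← neg_mul] at h
        rw [mul_div_right_comm]
        exact h.trans_eq (by ring)
    _ = _ := by
        rw [Finset.sum_add_distrib, Finset.sum_add_distrib, ← Finset.mul_sum, ← Finset.mul_sum,
          hone]

/-- **EXP3 potential-function inequality.**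
Given nonnegative estimated losses `ℓ̂_{i,t}`, weights `w_{i,1} = 1`,
`w_{i,t+1} = w_{i,t} · exp(-η ℓ̂_{i,t})`, and probabilities
`π_{i,t} = w_{i,t} / ∑_j w_{j,t}`, for every arm `i*`:
`-∑_t ℓ̂_{i*,t} ≤ -∑_t ∑_i π_{i,t} ℓ̂_{i,t} + η ∑_t ∑_i π_{i,t} ℓ̂_{i,t}² + (ln K)/η`. -/
theorem exp3_potential_bound
    (K T : ℕ) (hK : 1 ≤ K) (hT : 1 ≤ T) (η : ℝ) (hη : 0 < η)
    (ℓhat : Fin K → Fin T → ℝ) (hℓ : ∀ i t, 0 ≤ ℓhat i t)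
    (w : Fin K → ℕ → ℝ)
    (hw0 : ∀ i, w i 0 = 1)
    (hwstep : ∀ i (t : Fin T), w i (t + 1) = w i t * Real.exp (-η * ℓhat i t))
    (π : Fin K → Fin T → ℝ)
    (hπ : ∀ i t, π i t = w i t / ∑ j, w j t)
    (istar : Fin K) :
    -∑ t, ℓhat istar t ≤
      -(∑ t, ∑ i, π i t * ℓhat i t) + η * ∑ t, ∑ i, π i t * ℓhat i t ^ 2 +
        Real.log K / η := by
  have hpos : ∀ t, t ≤ T → ∀ i, 0 < w i t := by
    intro t
    induction t with
    | zero => intro _ i; simp [hw0]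
    | succ t ih =>
      intro ht i
      rw [hwstep i ⟨t, ht⟩]
      exact mul_pos (ih (by omega) i) (Real.exp_pos _)
  have : Nonempty (Fin K) := ⟨istar⟩
  have hlow : Real.log (w istar T) = -η * ∑ t, ℓhat istar t := by
    have h := Fin.sum_univ_telescope (fun t => Real.log (w istar t)) T
    simp only [hw0, Real.log_one, sub_zero] at h
    rw [← h, Finset.mul_sum]
    refine Finset.sum_congr rfl fun t _ => ?_
    rw [hwstep, Real.log_mul (hpos t t.2.le istar).ne' (Real.exp_pos _).ne', Real.log_exp]
    ring
  have hup : Real.log (∑ i, w i T) - Real.log K ≤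
      -η * ∑ t, ∑ i, π i t * ℓhat i t + η ^ 2 * ∑ t, ∑ i, π i t * ℓhat i t ^ 2 := by
    have h := Fin.sum_univ_telescope (fun t => Real.log (∑ i, w i t)) T
    simp only [hw0, Finset.sum_const, Finset.card_univ, Fintype.card_fin, nsmul_eq_mul,
      mul_one] at h
    rw [← h, Finset.mul_sum, Finset.mul_sum, ← Finset.sum_add_distrib]
    refine Finset.sum_le_sum fun t _ => ?_
    simp only [hwstep, hπ]
    exact log_sum_mul_exp_sub_log_sum_le hη.le (hpos t t.2.le) (fun i => hℓ i t)
  have hle : Real.log (w istar T) ≤ Real.log (∑ i, w i T) :=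
    Real.log_le_log (hpos T le_rfl istar)
      (Finset.single_le_sum (f := fun i => w i T) (fun i _ => (hpos T le_rfl i).le)
        (Finset.mem_univ istar))
  refine le_of_mul_le_mul_left ?_ hη
  rw [mul_add, mul_div_cancel₀ _ hη.ne']
  linarith
end

section
/- Let f ∈ (0,1], π ∈ (0,1], and ℓ ∈ [0,1]. Let B be a {0,1}-valued random variable with P(B = 1) = π·f, and let G be a geometric random variable with parameter f that is independent of B. Define the loss estimator ℓ̂ = (ℓ/π)·B·G. Then E[ℓ̂] = ℓ, and moreover π·E[ℓ̂²] ≤ 2·ℓ²/f. -/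
open MeasureTheory ProbabilityTheory
open scoped ENNReal

/-- The mean of a geometric variable of parameter `f` on `{1, 2, …}`, as a series. -/
lemma hasSum_geometric_mean {f : ℝ} (hf : f ∈ Set.Ioc (0 : ℝ) 1) :
    HasSum (fun n : ℕ => ((n + 1 : ℕ) : ℝ) * ((1 - f) ^ n * f)) (1 / f) := by
  obtain ⟨h0, h1⟩ := hf
  have hr : ‖1 - f‖ < 1 := by rw [Real.norm_of_nonneg (by linarith)]; linarith
  have h := (hasSum_choose_mul_geometric_of_norm_lt_one 1 hr).mul_right f
  convert! h using 1
  · ext n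
    simp only [Nat.choose_one_right]
    ring
  · rw [sub_sub_cancel]
    field_simp

/-- The second moment of a geometric variable of parameter `f` on `{1, 2, …}`, as a series. -/
lemma hasSum_geometric_second_moment {f : ℝ} (hf : f ∈ Set.Ioc (0 : ℝ) 1) :
    HasSum (fun n : ℕ => ((n + 1 : ℕ) : ℝ) ^ 2 * ((1 - f) ^ n * f)) ((2 - f) / f ^ 2) := by
  have h0 := hf.1
  have hr : ‖1 - f‖ < 1 := by rw [Real.norm_of_nonneg (by linarith [hf.2])]; linarith
  have h := (((hasSum_choose_mul_geometric_of_norm_lt_one 2 hr).mul_right f).mul_left 2).sub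
    (hasSum_geometric_mean hf)
  convert! h using 1
  · ext n
    rw [Nat.cast_choose_two]
    push_cast
    ring
  · rw [sub_sub_cancel]
    field_simp
    ring

/-- The expectation of `φ (G)` for a variable `G` that is geometric on `{1, 2, …}`. -/
lemma lintegral_comp_of_geometric {Ω : Type*} [MeasurableSpace Ω] {P : Measure Ω} {f : ℝ}
    (hf : f ∈ Set.Ioc (0 : ℝ) 1) {G : Ω → ℕ} (hGmeas : Measurable G)
    (hG : ∀ n : ℕ, 1 ≤ n → P {ω | G ω = n} = ENNReal.ofReal ((1 - f) ^ (n - 1) * f))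
    {φ : ℕ → ℝ} (hφ : ∀ n, 0 ≤ φ n) (hφ0 : φ 0 = 0) {s : ℝ}
    (hs : HasSum (fun n : ℕ => φ (n + 1) * ((1 - f) ^ n * f)) s) :
    ∫⁻ ω, ENNReal.ofReal (φ (G ω)) ∂P = ENNReal.ofReal s := by
  have hw (n : ℕ) : 0 ≤ (1 - f) ^ n * f :=
    mul_nonneg (pow_nonneg (sub_nonneg.2 hf.2) n) hf.1.le
  rw [← lintegral_map (f := fun n => ENNReal.ofReal (φ n)) (by fun_prop) hGmeas,
    lintegral_countable', tsum_eq_zero_add' ENNReal.summable, hφ0, ENNReal.ofReal_zero, zero_mul,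
    zero_add, ← hs.tsum_eq,
    ENNReal.ofReal_tsum_of_nonneg (fun n => mul_nonneg (hφ _) (hw n)) hs.summable]
  refine tsum_congr fun n => ?_
  rw [Measure.map_apply hGmeas (measurableSet_singleton _), ENNReal.ofReal_mul (hφ _)]
  congr 1
  exact hG (n + 1) n.succ_pos

/-- The expectation of a `{0,1}`-valued variable is the probability that it equals `1`. -/
lemma lintegral_ofReal_eq_measure_eq_one {Ω : Type*} [MeasurableSpace Ω] {P : Measure Ω}
    {B : Ω → ℝ} (hBmeas : Measurable B) (hB01 : ∀ ω, B ω = 0 ∨ B ω = 1) :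
    ∫⁻ ω, ENNReal.ofReal (B ω) ∂P = P {ω | B ω = 1} := by
  have hset : MeasurableSet {ω | B ω = 1} := hBmeas (measurableSet_singleton (1 : ℝ))
  rw [← lintegral_indicator_one hset]
  refine lintegral_congr fun ω => ?_
  rcases hB01 ω with h | h <;> simp [Set.indicator, h]

/-- The expectation of `c * B * φ (G)` for an indicator `B` independent of a geometric `G`. -/
lemma lintegral_const_mul_indicator_mul_geometric {Ω : Type*} [MeasurableSpace Ω]
    {P : Measure Ω} {f q c : ℝ} (hf : f ∈ Set.Ioc (0 : ℝ) 1) (hq : 0 ≤ q) (hc : 0 ≤ c)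
    {B : Ω → ℝ} (hBmeas : Measurable B) (hB01 : ∀ ω, B ω = 0 ∨ B ω = 1)
    (hB : P {ω | B ω = 1} = ENNReal.ofReal q) {G : Ω → ℕ} (hGmeas : Measurable G)
    (hG : ∀ n : ℕ, 1 ≤ n → P {ω | G ω = n} = ENNReal.ofReal ((1 - f) ^ (n - 1) * f))
    (hindep : IndepFun B G P) {φ : ℕ → ℝ} (hφ : ∀ n, 0 ≤ φ n) (hφ0 : φ 0 = 0) {s : ℝ}
    (hs : HasSum (fun n : ℕ => φ (n + 1) * ((1 - f) ^ n * f)) s) :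
    ∫⁻ ω, ENNReal.ofReal (c * B ω * φ (G ω)) ∂P = ENNReal.ofReal (c * q * s) := by
  have hB0 (ω : Ω) : 0 ≤ B ω := by rcases hB01 ω with h | h <;> simp [h]
  have hind : IndepFun (fun ω => ENNReal.ofReal (B ω)) (fun ω => ENNReal.ofReal (φ (G ω))) P :=
    hindep.comp ENNReal.measurable_ofReal
      (Measurable.of_discrete (f := fun n => ENNReal.ofReal (φ n)))
  have hφG : Measurable fun ω => ENNReal.ofReal (φ (G ω)) :=
    (Measurable.of_discrete (f := fun n => ENNReal.ofReal (φ n))).comp hGmeas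
  calc ∫⁻ ω, ENNReal.ofReal (c * B ω * φ (G ω)) ∂P
      = ∫⁻ ω, ENNReal.ofReal c * (ENNReal.ofReal (B ω) * ENNReal.ofReal (φ (G ω))) ∂P := by
        refine lintegral_congr fun ω => ?_
        rw [mul_assoc, ENNReal.ofReal_mul hc, ENNReal.ofReal_mul (hB0 ω)]
    _ = ENNReal.ofReal c * (ENNReal.ofReal q * ENNReal.ofReal s) := by
        rw [lintegral_const_mul _ (by fun_prop),
          lintegral_mul_eq_lintegral_mul_lintegral_of_indepFun''
            hBmeas.ennreal_ofReal.aemeasurable hφG.aemeasurable hind,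
          lintegral_ofReal_eq_measure_eq_one hBmeas hB01, hB,
          lintegral_comp_of_geometric hf hGmeas hG hφ hφ0 hs]
    _ = ENNReal.ofReal (c * q * s) := by
        rw [mul_assoc, ENNReal.ofReal_mul hc, ENNReal.ofReal_mul hq]

/-- **Moments of the 3-Phase EXP3 loss estimator.**
Let `f, π ∈ (0,1]` and `ℓ ∈ [0,1]`.  Let `B` be a `{0,1}`-valued random variable
with `P(B = 1) = π * f`, and let `G` be a geometric random variable with parameter
`f` independent of `B`.  The estimator `ℓ̂ = (ℓ/π) * B * G` satisfies
`E[ℓ̂] = ℓ` and `π * E[ℓ̂²] ≤ 2 ℓ² / f`. -/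
theorem exp3_loss_estimator_moments
    {Ω : Type*} [MeasurableSpace Ω] (P : Measure Ω) [IsProbabilityMeasure P]
    (f π ℓ : ℝ) (hf : f ∈ Set.Ioc (0 : ℝ) 1) (hπ : π ∈ Set.Ioc (0 : ℝ) 1)
    (hℓ : ℓ ∈ Set.Icc (0 : ℝ) 1)
    (B : Ω → ℝ) (hBmeas : Measurable B)
    (hB01 : ∀ ω, B ω = 0 ∨ B ω = 1)
    (hB : P {ω | B ω = 1} = ENNReal.ofReal (π * f))
    (G : Ω → ℕ) (hGmeas : Measurable G)
    (hG : ∀ n : ℕ, 1 ≤ n → P {ω | G ω = n} = ENNReal.ofReal ((1 - f) ^ (n - 1) * f))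
    (hindep : IndepFun B G P) :
    (∫⁻ ω, ENNReal.ofReal (ℓ / π * B ω * (G ω : ℝ)) ∂P) = ENNReal.ofReal ℓ ∧
      ENNReal.ofReal π * (∫⁻ ω, ENNReal.ofReal ((ℓ / π * B ω * (G ω : ℝ)) ^ 2) ∂P) ≤
        ENNReal.ofReal (2 * ℓ ^ 2 / f) := by
  obtain ⟨hf0, hf1⟩ := id hf
  have hπ0 := hπ.1
  have hℓ0 := hℓ.1
  have hq : 0 ≤ π * f := by positivity
  constructor
  · rw [lintegral_const_mul_indicator_mul_geometric (φ := fun n => (n : ℝ)) hf hq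
      (by positivity) hBmeas hB01 hB hGmeas hG hindep (fun n => n.cast_nonneg) Nat.cast_zero
      (hasSum_geometric_mean hf)]
    congr 1
    field_simp
  · have hsq (ω : Ω) :
        (ℓ / π * B ω * (G ω : ℝ)) ^ 2 = (ℓ / π) ^ 2 * B ω * (G ω : ℝ) ^ 2 := by
      rcases hB01 ω with h | h <;> rw [h] <;> ring
    simp_rw [hsq]
    rw [lintegral_const_mul_indicator_mul_geometric (φ := fun n => (n : ℝ) ^ 2) hf hq
      (by positivity) hBmeas hB01 hB hGmeas hG hindep (fun n => by positivity) (by simp)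
      (hasSum_geometric_second_moment hf), ← ENNReal.ofReal_mul hπ0.le]
    apply ENNReal.ofReal_le_ofReal
    calc π * ((ℓ / π) ^ 2 * (π * f) * ((2 - f) / f ^ 2)) = (2 - f) * ℓ ^ 2 / f := by
          field_simp
      _ ≤ 2 * ℓ ^ 2 / f := by
          gcongr
          linarith
end
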